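/- Let n ≥ 3, V ∈ RH_q with q > n/2, with critical radius function ρ. Let p : (0,∞) × ℝⁿ × ℝⁿ → [0,∞) be measurable, let δ ∈ (0,1], and suppose that for every N > 0 there exist constants C, c > 0 such that |p_t(x,y) − p_t(x,z)| ≤ C t^{−n/2} (|y−z|/√t)^δ exp(−c|x−y|²/t) (1 + √t/ρ(x) + √t/ρ(y))^{−N} whenever |y−z| < |x−y|/2, together with the Gaussian size bound p_t(x,y) ≤ C t^{−n/2} exp(−c|x−y|²/t)(1+√t/ρ(x)+√t/ρ(y))^{−N}. Let 0 < α < n and K_α(x,y) = ∫₀^∞ t^{α/2} p_t(x,y) dt/t. Then for every N > 0 there exists a constant C such that |K_α(x,y) − K_α(x,z)| ≤ C (|y−z|/|x−y|)^δ (1 + |x−y|/ρ(x))^{−N} |x−y|^{α−n} whenever |y−z| < |x−y|/4. -/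

import Mathlib

open MeasureTheory Metric Set
open scoped ENNReal

noncomputable section

/-- Euclidean space `ℝⁿ`. -/
abbrev Eucl (n : ℕ) := EuclideanSpace ℝ (Fin n)

namespace SchrodingerCommutators

variable {n : ℕ}

/-- The average `(1/|B(x,r)|) ∫_{B(x,r)} f` of a function over a ball. -/
def ballAvg (f : Eucl n → ℝ) (x : Eucl n) (r : ℝ) : ℝ :=
  (volume (ball x r)).toReal⁻¹ * ∫ y in ball x r, f y

/-- `V` is a nonnegative locally integrable function in the reverse Hölder class `RH_q`:
`((1/|B|)∫_B V^q)^{1/q} ≤ (C/|B|) ∫_B V` for all balls `B`. -/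
def IsRH (V : Eucl n → ℝ) (q : ℝ) : Prop :=
  (∀ x, 0 ≤ V x) ∧ LocallyIntegrable V volume ∧
    ∃ C > 0, ∀ (x : Eucl n) (r : ℝ), 0 < r →
      (ballAvg (fun y => V y ^ q) x r) ^ (1 / q) ≤ C * ballAvg V x r

/-- The critical radius function `ρ(x) = sup {r > 0 : r^{2-n} ∫_{B(x,r)} V ≤ 1}`. -/
def critRad (V : Eucl n → ℝ) (x : Eucl n) : ℝ :=
  sSup {r : ℝ | 0 < r ∧ r ^ (2 - (n : ℝ)) * ∫ y in ball x r, V y ≤ 1}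

/-- The `A_p^{L,θ}` condition for a weight `w`, relative to a critical radius function `ρ`:
`(∫_B w)^{1/p} (∫_B w^{-1/(p-1)})^{1/p'} ≤ C |B| (1 + r/ρ(x))^θ` for all balls `B = B(x,r)`. -/
def MemApLtheta (ρ : Eucl n → ℝ) (w : Eucl n → ℝ) (p θ : ℝ) : Prop :=
  ∃ C > 0, ∀ (x : Eucl n) (r : ℝ), 0 < r →
    (∫ y in ball x r, w y) ^ (1 / p) *
        (∫ y in ball x r, w y ^ (-(1 / (p - 1)))) ^ (1 - 1 / p)
      ≤ C * (volume (ball x r)).toReal * (1 + r / ρ x) ^ θ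

/-- `w ∈ A_p^L = ∪_{θ>0} A_p^{L,θ}`. -/
def MemApL (ρ : Eucl n → ℝ) (w : Eucl n → ℝ) (p : ℝ) : Prop :=
  ∃ θ > 0, MemApLtheta ρ w p θ

/-- The conjugate exponent `r' = r/(r-1)`. -/
def conjExp (r : ℝ) : ℝ := r / (r - 1)

/-- `b` satisfies the `BMO_L^θ` bound with constant `C`:
`(1/|B|) ∫_B |b - b_B| ≤ C (1 + r/ρ(x))^θ` for all balls `B = B(x,r)`. -/
def BMOLBound (ρ : Eucl n → ℝ) (b : Eucl n → ℝ) (θ C : ℝ) : Prop :=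
  ∀ (x : Eucl n) (r : ℝ), 0 < r →
    (volume (ball x r)).toReal⁻¹ * (∫ y in ball x r, |b y - ballAvg b x r|)
      ≤ C * (1 + r / ρ x) ^ θ

/-- `b ∈ BMO_L^θ`: `b` is locally integrable and satisfies the `BMO_L^θ` bound
for some finite constant. -/
def MemBMOL (ρ : Eucl n → ℝ) (b : Eucl n → ℝ) (θ : ℝ) : Prop :=
  LocallyIntegrable b volume ∧ ∃ C ≥ 0, BMOLBound ρ b θ C

/-- `‖b‖_θ`: the least constant in the `BMO_L^θ` bound. -/
def bmoLNorm (ρ : Eucl n → ℝ) (b : Eucl n → ℝ) (θ : ℝ) : ℝ :=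
  sInf {C : ℝ | 0 ≤ C ∧ BMOLBound ρ b θ C}

/-- The local maximal function `M_{ρ,α} g(x) = sup_{x ∈ B(y,r), r ≤ αρ(y)} (1/|B|)∫_B |g|`. -/
def MrhoLoc (ρ : Eucl n → ℝ) (α : ℝ) (g : Eucl n → ℝ) (x : Eucl n) : ℝ :=
  sSup {m : ℝ | ∃ (y : Eucl n) (r : ℝ), 0 < r ∧ r ≤ α * ρ y ∧ x ∈ ball y r ∧
    m = ballAvg (fun z => |g z|) y r}

/-- The local sharp maximal function
`M^♯_{ρ,α} g(x) = sup_{x ∈ B(y,r), r ≤ αρ(y)} (1/|B|)∫_B |g - g_B|`. -/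
def MrhoSharp (ρ : Eucl n → ℝ) (α : ℝ) (g : Eucl n → ℝ) (x : Eucl n) : ℝ :=
  sSup {m : ℝ | ∃ (y : Eucl n) (r : ℝ), 0 < r ∧ r ≤ α * ρ y ∧ x ∈ ball y r ∧
    m = ballAvg (fun z => |g z - ballAvg g y r|) y r}

/-- A covering family of critical balls `Q_j = B(x_j, ρ(x_j))`: the balls cover `ℝⁿ`
and the dilates `σQ_j` have finite overlap `Σ_j χ_{σQ_j} ≤ C σ^{N₁}` for every `σ ≥ 1`. -/
def IsCriticalCovering (V : Eucl n → ℝ) (c : ℕ → Eucl n) : Prop :=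
  (⋃ k, ball (c k) (critRad V (c k))) = univ ∧
    ∀ σ : ℝ, 1 ≤ σ → ∃ C > 0, ∃ N₁ : ℝ, ∀ x : Eucl n,
      (∑' k : ℕ, (ball (c k) (σ * critRad V (c k))).indicator (fun _ => (1 : ℝ≥0∞)) x)
        ≤ ENNReal.ofReal (C * σ ^ N₁)

/-- The operator `G_{κ,α,s}` (with decay parameter `N`):
`G f(x) = sup_{Q ∋ x critical} Σ_k 2^{-Nk} (|2^k κQ|^{αs/n - 1} ∫_{2^k κQ} |f|^s)^{1/s}`. -/
def Gop (V : Eucl n → ℝ) (κ α s N : ℝ) (f : Eucl n → ℝ) (x : Eucl n) : ℝ :=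
  sSup {m : ℝ | ∃ y : Eucl n, x ∈ ball y (critRad V y) ∧
    m = ∑' k : ℕ, (2 : ℝ) ^ (-(N * (k : ℝ))) *
      ((volume (ball y (2 ^ k * κ * critRad V y))).toReal ^ (α * s / (n : ℝ) - 1) *
        ∫ z in ball y (2 ^ k * κ * critRad V y), |f z| ^ s) ^ (1 / s)}

/-- The operator `H_{κ,s}` (with decay parameter `N`):
`H f(x) = sup_{Q ∋ x critical} Σ_k 2^{-Nk} (|2^k κQ|⁻¹ ∫_{2^k κQ} |f|^s)^{1/s}`. -/
def Hop (V : Eucl n → ℝ) (κ s N : ℝ) (f : Eucl n → ℝ) (x : Eucl n) : ℝ :=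
  sSup {m : ℝ | ∃ y : Eucl n, x ∈ ball y (critRad V y) ∧
    m = ∑' k : ℕ, (2 : ℝ) ^ (-(N * (k : ℝ))) *
      ((volume (ball y (2 ^ k * κ * critRad V y))).toReal⁻¹ *
        ∫ z in ball y (2 ^ k * κ * critRad V y), |f z| ^ s) ^ (1 / s)}

/-- The fractional maximal function
`M_{α,s} f(x) = sup_{B ∋ x} (|B|^{sα/n - 1} ∫_B |f|^s)^{1/s}`. -/
def Mfrac (α s : ℝ) (f : Eucl n → ℝ) (x : Eucl n) : ℝ :=
  sSup {m : ℝ | ∃ (y : Eucl n) (r : ℝ), 0 < r ∧ x ∈ ball y r ∧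
    m = ((volume (ball y r)).toReal ^ (s * α / (n : ℝ) - 1) *
      ∫ z in ball y r, |f z| ^ s) ^ (1 / s)}

/-- The localized fractional maximal operator
`M̃_{α,s} f = Σ_k χ_{Q_k} M_{α,s}(f χ_{κ'Q_k})` attached to a covering family of
critical balls `Q_k = B(c_k, ρ(c_k))` with dilates `κ'Q_k`. -/
def Mtilde (V : Eucl n → ℝ) (c : ℕ → Eucl n) (κ' α s : ℝ) (f : Eucl n → ℝ)
    (x : Eucl n) : ℝ :=
  ∑' k : ℕ, (ball (c k) (critRad V (c k))).indicator
    (fun x' => Mfrac α s ((ball (c k) (κ' * critRad V (c k))).indicator f) x') x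

/-- The weighted measure `w dx`. -/
def wMeasure (w : Eucl n → ℝ) : Measure (Eucl n) :=
  volume.withDensity fun x => ENNReal.ofReal (w x)

end SchrodingerCommutators
open SchrodingerCommutators

lemma critRad_nonneg {n : ℕ} (V : Eucl n → ℝ) (x : Eucl n) : 0 ≤ critRad V x :=
  Real.sSup_nonneg fun _ hr => hr.1.le

/-- The rescaled profile dominating the heat kernel estimates in the time variable. -/
def heatProfile (e N c u : ℝ) : ℝ :=
  u ^ (-e) * (1 + 1 / √u) ^ N * Real.exp (-c / u)

lemma heatProfile_nonneg {e N c u : ℝ} (hu : 0 ≤ u) : 0 ≤ heatProfile e N c u := by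
  unfold heatProfile
  positivity

lemma measurable_heatProfile (e N c : ℝ) : Measurable (heatProfile e N c) := by
  unfold heatProfile
  fun_prop

/-- A real power times a decaying exponential is bounded on `[1, ∞)`. -/
lemma exists_rpow_mul_exp_neg_le (k : ℝ) {c : ℝ} (hc : 0 < c) :
    ∃ M : ℝ, ∀ v : ℝ, 1 ≤ v → v ^ k * Real.exp (-c * v) ≤ M := by
  obtain ⟨m, hm⟩ := exists_nat_ge k
  refine ⟨m.factorial / c ^ m, fun v hv => ?_⟩
  have h1 : v ^ k ≤ v ^ m := by
    rw [← Real.rpow_natCast]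
    exact Real.rpow_le_rpow_of_exponent_le hv hm
  have h2 := Real.pow_div_factorial_le_exp (c * v) (by positivity) m
  have h3 : v ^ m ≤ m.factorial / c ^ m * Real.exp (c * v) := by
    rw [div_le_iff₀ (by positivity), mul_pow] at h2
    rw [div_mul_eq_mul_div, le_div_iff₀ (by positivity)]
    linarith
  calc v ^ k * Real.exp (-c * v)
      ≤ (m.factorial / c ^ m * Real.exp (c * v)) * Real.exp (-c * v) := by
        gcongr
        exact h1.trans h3
    _ = m.factorial / c ^ m := by
        rw [mul_assoc, ← Real.exp_add]
        simp

lemma integrableOn_heatProfile {e N c : ℝ} (he : 1 < e) (hN : 0 ≤ N) (hc : 0 < c) :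
    IntegrableOn (heatProfile e N c) (Ioi 0) := by
  rw [← Ioc_union_Ioi_eq_Ioi (zero_le_one' ℝ)]
  refine IntegrableOn.union ?_ ?_
  · obtain ⟨M, hM⟩ := exists_rpow_mul_exp_neg_le (e + N / 2) hc
    refine Measure.integrableOn_of_bounded (M := 2 ^ N * M) (by simp)
      (measurable_heatProfile e N c).aestronglyMeasurable ?_
    filter_upwards [ae_restrict_mem measurableSet_Ioc] with u hu
    have hu0 : 0 < u := hu.1
    rw [Real.norm_of_nonneg (heatProfile_nonneg hu0.le)]
    have hs : √u ≤ 1 := Real.sqrt_le_one.mpr hu.2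
    have hs0 : 0 < √u := Real.sqrt_pos.mpr hu0
    have h1 : (1 + 1 / √u) ^ N ≤ 2 ^ N * u⁻¹ ^ (N / 2) := by
      have h2 : u⁻¹ ^ (N / 2) = (1 / √u) ^ N := by
        rw [one_div, ← Real.sqrt_inv, Real.sqrt_eq_rpow, ← Real.rpow_mul (by positivity)]
        congr 1
        ring
      rw [h2, ← Real.mul_rpow (by norm_num) (by positivity)]
      have : 1 ≤ 1 / √u := by rwa [le_div_iff₀ hs0, one_mul]
      gcongr
      linarith
    have h3 := hM u⁻¹ ((one_le_inv₀ hu0).mpr hu.2)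
    calc heatProfile e N c u
        ≤ u ^ (-e) * (2 ^ N * u⁻¹ ^ (N / 2)) * Real.exp (-c / u) := by
          unfold heatProfile
          gcongr
      _ = 2 ^ N * (u⁻¹ ^ (e + N / 2) * Real.exp (-c * u⁻¹)) := by
          rw [Real.rpow_add (by positivity), Real.inv_rpow hu0.le e, ← Real.rpow_neg hu0.le,
            div_eq_mul_inv]
          ring_nf
      _ ≤ 2 ^ N * M := by gcongr
  · refine Integrable.mono'
      ((integrableOn_Ioi_rpow_of_lt (neg_lt_neg he) one_pos).const_mul (2 ^ N))
      (measurable_heatProfile e N c).aestronglyMeasurable ?_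
    filter_upwards [ae_restrict_mem measurableSet_Ioi] with u hu
    have hu1 : 1 < u := hu
    have hu0 : 0 < u := by linarith
    rw [Real.norm_of_nonneg (heatProfile_nonneg hu0.le)]
    have hs : 1 ≤ √u := Real.one_le_sqrt.mpr hu1.le
    have h1 : 1 + 1 / √u ≤ 2 := by
      have : 1 / √u ≤ 1 := by rwa [div_le_one (by positivity)]
      linarith
    have h2 : Real.exp (-c / u) ≤ 1 :=
      Real.exp_le_one_iff.mpr (div_nonpos_of_nonpos_of_nonneg (by linarith) hu0.le)
    calc heatProfile e N c u ≤ u ^ (-e) * 2 ^ N * 1 := by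
          unfold heatProfile
          gcongr
      _ = 2 ^ N * u ^ (-e) := by ring

/-- The decay at scale `√t` is traded for decay at scale `d` at the cost of a power of `d/√t`. -/
lemma one_add_div_rpow_neg_le {s d r r' N : ℝ} (hs : 0 < s) (hd : 0 ≤ d) (hr : 0 ≤ r)
    (hr' : 0 ≤ r') (hN : 0 ≤ N) :
    (1 + s / r + s / r') ^ (-N) ≤ (1 + d / r) ^ (-N) * (1 + d / s) ^ N := by
  have h1 : 1 + d / r ≤ (1 + s / r + s / r') * (1 + d / s) := by
    have e : d / r = s / r * (d / s) := by field_simp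
    have : 0 ≤ s / r := by positivity
    have : 0 ≤ s / r' := by positivity
    have : 0 ≤ d / s := by positivity
    have : 0 ≤ s / r' * (d / s) := by positivity
    rw [e]
    linarith
  have h2 := Real.rpow_le_rpow (by positivity) h1 hN
  rw [Real.mul_rpow (by positivity) (by positivity)] at h2
  rw [Real.rpow_neg (by positivity), Real.rpow_neg (by positivity), inv_mul_eq_div,
    le_div_iff₀ (by positivity), inv_mul_le_iff₀ (by positivity)]
  exact h2

lemma holder_bound_le_heatProfile {m α δ N C c t d h r r' : ℝ} (hN : 0 ≤ N) (hC : 0 ≤ C)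
    (ht : 0 < t) (hd : 0 < d) (hh : 0 ≤ h) (hr : 0 ≤ r) (hr' : 0 ≤ r') :
    t ^ (α / 2 - 1) * (C * t ^ (-m / 2) * (h / √t) ^ δ * Real.exp (-c * d ^ 2 / t) *
        (1 + √t / r + √t / r') ^ (-N)) ≤
      C * (h / d) ^ δ * (1 + d / r) ^ (-N) * d ^ (α - m - 2) *
        heatProfile (1 + (m - α + δ) / 2) N c ((d ^ 2)⁻¹ * t) := by
  have hs : 0 < √t := Real.sqrt_pos.mpr ht
  have hsqrt : 1 / √((d ^ 2)⁻¹ * t) = d / √t := by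
    rw [Real.sqrt_mul (by positivity), Real.sqrt_inv, Real.sqrt_sq hd.le]
    field_simp
  have hexp : -c / ((d ^ 2)⁻¹ * t) = -c * d ^ 2 / t := by field_simp
  have hpow : t ^ (α / 2 - 1) * t ^ (-m / 2) * (h / √t) ^ δ =
      (h / d) ^ δ * d ^ (α - m - 2) * ((d ^ 2)⁻¹ * t) ^ (-(1 + (m - α + δ) / 2)) := by
    rw [Real.div_rpow hh hs.le, Real.div_rpow hh hd.le, Real.mul_rpow (by positivity) ht.le,
      Real.inv_rpow (by positivity), Real.rpow_neg (x := d ^ 2) (by positivity), inv_inv,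
      ← Real.rpow_natCast d 2, ← Real.rpow_mul hd.le, Real.sqrt_eq_rpow, ← Real.rpow_mul ht.le,
      div_eq_mul_inv (h ^ δ), div_eq_mul_inv (h ^ δ), ← Real.rpow_neg ht.le,
      ← Real.rpow_neg hd.le]
    have e1 : t ^ (-(1 + (m - α + δ) / 2)) =
        t ^ (α / 2 - 1) * t ^ (-m / 2) * t ^ (-(1 / 2 * δ)) := by
      rw [← Real.rpow_add ht, ← Real.rpow_add ht]
      congr 1
      ring
    have e2 : d ^ (-δ) * d ^ (α - m - 2) * d ^ (((2 : ℕ) : ℝ) * (1 + (m - α + δ) / 2)) = 1 := by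
      rw [← Real.rpow_add hd, ← Real.rpow_add hd]
      convert Real.rpow_zero d using 2
      push_cast
      ring
    rw [e1]
    linear_combination
      (-(h ^ δ * (t ^ (α / 2 - 1) * t ^ (-m / 2) * t ^ (-(1 / 2 * δ))))) * e2
  have key := one_add_div_rpow_neg_le hs hd.le hr hr' hN
  unfold heatProfile
  rw [hsqrt, hexp]
  calc _ = C * (t ^ (α / 2 - 1) * t ^ (-m / 2) * (h / √t) ^ δ) * Real.exp (-c * d ^ 2 / t) *
        (1 + √t / r + √t / r') ^ (-N) := by ring
    _ ≤ C * (t ^ (α / 2 - 1) * t ^ (-m / 2) * (h / √t) ^ δ) * Real.exp (-c * d ^ 2 / t) *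
        ((1 + d / r) ^ (-N) * (1 + d / √t) ^ N) := by gcongr
    _ = _ := by
        rw [hpow]
        ring

/-- A Gaussian upper bound makes the defining integral of the fractional kernel converge. -/
lemma integrableOn_rpow_mul_of_le_gaussian {m α C c d : ℝ} (hαm : α < m) (hc : 0 < c) (hd : 0 < d)
    {f : ℝ → ℝ} (hf : Measurable f) (hf0 : ∀ t, 0 ≤ f t)
    (hle : ∀ t, 0 < t → f t ≤ C * t ^ (-m / 2) * Real.exp (-c * d ^ 2 / t)) :
    IntegrableOn (fun t => t ^ (α / 2 - 1) * f t) (Ioi 0) := by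
  have hint := integrableOn_heatProfile (e := 1 + (m - α) / 2) (N := 0) (c := c * d ^ 2)
    (by linarith) le_rfl (by positivity)
  refine Integrable.mono' (hint.const_mul C)
    (Measurable.aestronglyMeasurable (by fun_prop)) ?_
  filter_upwards [ae_restrict_mem measurableSet_Ioi] with t ht
  have ht0 : 0 < t := ht
  rw [Real.norm_of_nonneg (mul_nonneg (by positivity) (hf0 t))]
  calc t ^ (α / 2 - 1) * f t
      ≤ t ^ (α / 2 - 1) * (C * t ^ (-m / 2) * Real.exp (-c * d ^ 2 / t)) := by
        gcongr
        exact hle t ht0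
    _ = C * heatProfile (1 + (m - α) / 2) 0 (c * d ^ 2) t := by
        have : t ^ (-(1 + (m - α) / 2)) = t ^ (α / 2 - 1) * t ^ (-m / 2) := by
          rw [← Real.rpow_add ht0]
          congr 1
          ring
        rw [heatProfile, this, Real.rpow_zero, neg_mul]
        ring

/-- Hölder estimate for the kernel `K_α(x,y) = ∫₀^∞ t^{α/2} p_t(x,y) dt/t`
of the fractional integral, from the Gaussian and Hölder bounds for the heat kernel:
`|K_α(x,y) - K_α(x,z)| ≤ C (|y-z|/|x-y|)^δ (1+|x-y|/ρ(x))^{-N} |x-y|^{α-n}` for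
`|y-z| < |x-y|/4`. -/
theorem fractional_kernel_holder {n : ℕ} (hn : 3 ≤ n) (V : Eucl n → ℝ)
    (q : ℝ) (hq : (n : ℝ) / 2 < q) (hV : IsRH V q)
    (p : ℝ → Eucl n → Eucl n → ℝ)
    (hmeas : Measurable fun t : ℝ × Eucl n × Eucl n => p t.1 t.2.1 t.2.2)
    (hpos : ∀ t x y, 0 ≤ p t x y)
    (δ : ℝ) (hδ0 : 0 < δ) (hδ1 : δ ≤ 1)
    (hgauss : ∀ N : ℝ, 0 < N → ∃ C > (0 : ℝ), ∃ c > (0 : ℝ), ∀ t : ℝ, 0 < t →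
      ∀ x y : Eucl n,
        p t x y ≤ C * t ^ (-(n : ℝ) / 2) * Real.exp (-c * dist x y ^ 2 / t) *
          (1 + Real.sqrt t / critRad V x + Real.sqrt t / critRad V y) ^ (-N))
    (hholder : ∀ N : ℝ, 0 < N → ∃ C > (0 : ℝ), ∃ c > (0 : ℝ), ∀ t : ℝ, 0 < t →
      ∀ x y z : Eucl n, dist y z < dist x y / 2 →
        |p t x y - p t x z| ≤
          C * t ^ (-(n : ℝ) / 2) * (dist y z / Real.sqrt t) ^ δ *
            Real.exp (-c * dist x y ^ 2 / t) *
            (1 + Real.sqrt t / critRad V x + Real.sqrt t / critRad V y) ^ (-N))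
    (α : ℝ) (hα : 0 < α) (hαn : α < n)
    (K : Eucl n → Eucl n → ℝ)
    (hK : ∀ x y, K x y = ∫ t in Set.Ioi (0 : ℝ), t ^ (α / 2 - 1) * p t x y) :
    ∀ N : ℝ, 0 < N → ∃ C > (0 : ℝ), ∀ x y z : Eucl n, dist y z < dist x y / 4 →
      |K x y - K x z| ≤
        C * (dist y z / dist x y) ^ δ * (1 + dist x y / critRad V x) ^ (-N) *
          dist x y ^ (α - (n : ℝ)) := by
  intro N hN
  obtain ⟨C₁, hC₁, c₁, hc₁, hG⟩ := hgauss 1 one_pos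
  obtain ⟨C, hC, c, hc, hH⟩ := hholder N hN
  have hint := integrableOn_heatProfile (e := 1 + ((n : ℝ) - α + δ) / 2) (by linarith) hN.le hc
  set I := ∫ u in Ioi (0 : ℝ), heatProfile (1 + ((n : ℝ) - α + δ) / 2) N c u with hI
  have hI0 : 0 ≤ I :=
    setIntegral_nonneg measurableSet_Ioi fun u (hu : 0 < u) => heatProfile_nonneg hu.le
  have hKint : ∀ x y, 0 < dist x y →
      IntegrableOn (fun t => t ^ (α / 2 - 1) * p t x y) (Ioi 0) := by
    intro x y hxy
    refine integrableOn_rpow_mul_of_le_gaussian (C := C₁) hαn hc₁ hxy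
      (hmeas.comp (g := fun t : ℝ × Eucl n × Eucl n => p t.1 t.2.1 t.2.2)
        (f := fun t : ℝ => (t, x, y)) (by fun_prop)) (fun t => hpos t x y) fun t ht => ?_
    have hx := critRad_nonneg V x
    have hy := critRad_nonneg V y
    refine (hG t ht x y).trans (mul_le_of_le_one_right (by positivity) ?_)
    refine Real.rpow_le_one_of_one_le_of_nonpos ?_ (by norm_num)
    rw [add_assoc]
    exact le_add_of_nonneg_right (by positivity)
  refine ⟨C * (I + 1), by positivity, fun x y z hyz => ?_⟩
  have hd : 0 < dist x y := by linarith [dist_nonneg (x := y) (y := z)]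
  have hxz : 0 < dist x z := by linarith [dist_triangle_right x y z]
  have hx := critRad_nonneg V x
  set A := C * (dist y z / dist x y) ^ δ * (1 + dist x y / critRad V x) ^ (-N) with hA
  have hA0 : 0 ≤ A := by positivity
  have hscale := integral_comp_mul_left_Ioi
    (heatProfile (1 + ((n : ℝ) - α + δ) / 2) N c) 0 (inv_pos.mpr (pow_pos hd 2))
  rw [mul_zero, ← hI, inv_inv, smul_eq_mul] at hscale
  have hdom : IntegrableOn (fun t => A * dist x y ^ (α - n - 2) *
      heatProfile (1 + ((n : ℝ) - α + δ) / 2) N c ((dist x y ^ 2)⁻¹ * t)) (Ioi 0) := by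
    refine Integrable.const_mul ?_ _
    refine (integrableOn_Ioi_comp_mul_left_iff _ 0 (inv_pos.mpr (pow_pos hd 2))).mpr ?_
    rwa [mul_zero]
  rw [hK, hK, ← integral_sub (hKint x y hd) (hKint x z hxz), ← Real.norm_eq_abs]
  calc _ ≤ ∫ t in Ioi (0 : ℝ), A * dist x y ^ (α - n - 2) *
        heatProfile (1 + ((n : ℝ) - α + δ) / 2) N c ((dist x y ^ 2)⁻¹ * t) := by
        refine norm_integral_le_of_norm_le hdom ?_
        filter_upwards [ae_restrict_mem measurableSet_Ioi] with t ht
        have ht0 : 0 < t := ht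
        rw [← mul_sub, norm_mul, Real.norm_of_nonneg (by positivity), Real.norm_eq_abs]
        exact (mul_le_mul_of_nonneg_left (hH t ht0 x y z (by linarith)) (by positivity)).trans
          (holder_bound_le_heatProfile hN.le hC.le ht0 hd dist_nonneg hx (critRad_nonneg V y))
    _ = A * I * (dist x y ^ (α - n - 2) * dist x y ^ 2) := by
        rw [integral_const_mul, hscale]
        ring
    _ = A * I * dist x y ^ (α - (n : ℝ)) := by
        rw [← Real.rpow_natCast (dist x y) 2, ← Real.rpow_add hd]
        congr 2
        push_cast
        ring
    _ ≤ A * (I + 1) * dist x y ^ (α - (n : ℝ)) := by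
        gcongr
        linarith
    _ = _ := by
        rw [hA]
        ring
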